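/- arXiv:1804.06037 — 3 statements merged into one kernel-verified Lean document; each statement's English description precedes it below -/
import Mathlib

section
/- Every finite word w over a totally ordered alphabet admits a unique factorization as a concatenation of Lyndon words \(w = u_1 u_2 \cdots u_m\) with \(u_1 \ge u_2 \ge \cdots \ge u_m\) in lexicographic order. -/
/-- A Lyndon word: a nonempty word strictly smaller (in lexicographic order)
than each of its proper nonempty suffixes. -/
def IsLyndon {α : Type*} [LinearOrder α] (w : List α) : Prop :=
  w ≠ [] ∧ ∀ u v : List α, u ≠ [] → v ≠ [] → w = u ++ v → w < v

theorem lyn_lt_cases {α : Type*} [LinearOrder α] : ∀ (x y : List α), x < y →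
    (∃ t, t ≠ [] ∧ y = x ++ t) ∨ (∀ p q, x ++ p < y ++ q)
  | [], y, h => by
    left
    refine ⟨y, ?_, rfl⟩
    rintro rfl
    exact absurd h (List.not_lt_nil _)
  | a :: x, [], h => absurd h (List.not_lt_nil _)
  | a :: x, b :: y, h => by
    rcases List.cons_lt_cons_iff.1 h with h | ⟨rfl, h'⟩
    · right
      intro p q
      exact List.cons_lt_cons_iff.2 (Or.inl h)
    · rcases lyn_lt_cases x y h' with ⟨t, ht, rfl⟩ | h
      · exact Or.inl ⟨t, ht, rfl⟩
      · right
        intro p q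
        exact List.cons_lt_cons_iff.2 (Or.inr ⟨rfl, h p q⟩)

theorem lyn_append {α : Type*} [LinearOrder α] {u v : List α} (hu : IsLyndon u)
    (hv : IsLyndon v) (h : u < v) : IsLyndon (u ++ v) := by
  have key : u ++ v < v := by
    rcases lyn_lt_cases u v h with ⟨t, ht, e⟩ | h
    · have h1 : v < t := hv.2 u t hu.1 ht e
      have h2 : u ++ v < u ++ t := List.append_left_lt h1
      rwa [← e] at h2
    · simpa using h v []
  refine ⟨by simp [hu.1], ?_⟩
  intro a s ha hs e
  rcases List.append_eq_append_iff.1 e with ⟨c, hc, hc'⟩ | ⟨c, hc, hc'⟩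
  · by_cases h0 : c = []
    · subst h0
      simp at hc'
      rwa [← hc']
    · exact lt_trans key (hv.2 c s h0 hs hc')
  · by_cases h0 : c = []
    · subst h0
      simp at hc'
      rwa [hc']
    · have h1 := hu.2 a c ha h0 hc
      rcases lyn_lt_cases u c h1 with ⟨t, ht, e'⟩ | h2
      · exfalso
        have l1 := congrArg List.length hc
        have l2 := congrArg List.length e'
        have l3 := List.length_pos_iff.2 ha
        simp at l1 l2
        omega
      · rw [hc']
        exact h2 v v

theorem lyn_insert {α : Type*} [LinearOrder α] : ∀ (T : List (List α)) (u : List α),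
    IsLyndon u → (∀ t ∈ T, IsLyndon t) → List.IsChain (· ≥ ·) T →
    ∃ L : List (List α), (∀ t ∈ L, IsLyndon t) ∧ List.IsChain (· ≥ ·) L ∧
      L.flatten = u ++ T.flatten
  | [], u, hu, _, _ => ⟨[u], by simpa using hu, by simp, by simp⟩
  | v :: T, u, hu, hT, hc => by
    by_cases h : u < v
    · have hv : IsLyndon v := hT v (by simp)
      obtain ⟨L, h1, h2, h3⟩ := lyn_insert T (u ++ v) (lyn_append hu hv h)
        (fun t ht => hT t (by simp [ht])) hc.tail
      exact ⟨L, h1, h2, by simp [h3]⟩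
    · refine ⟨u :: v :: T, ?_, ?_, by simp⟩
      · intro t ht
        rcases List.mem_cons.1 ht with rfl | ht
        · exact hu
        · exact hT t ht
      · exact List.isChain_cons_cons.2 ⟨not_lt.1 h, hc⟩

theorem lyn_exists {α : Type*} [LinearOrder α] : ∀ (w : List α),
    ∃ L : List (List α), (∀ t ∈ L, IsLyndon t) ∧ List.IsChain (· ≥ ·) L ∧ L.flatten = w
  | [] => ⟨[], by simp, by simp, by simp⟩
  | a :: w => by
    obtain ⟨L, h1, h2, h3⟩ := lyn_exists w
    have ha : IsLyndon [a] := by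
      refine ⟨by simp, ?_⟩
      intro u v hu hv e
      exfalso
      have l1 := congrArg List.length e
      have l2 := List.length_pos_iff.2 hu
      have l3 := List.length_pos_iff.2 hv
      simp at l1
      omega
    obtain ⟨L', h1', h2', h3'⟩ := lyn_insert L [a] ha h1 h2
    exact ⟨L', h1', h2', by simp [h3', h3]⟩

theorem lyn_suffix {α : Type*} : ∀ (T : List (List α)) (r q : List α), r ≠ [] →
    T.flatten = r ++ q → ∃ r1 s, s ≠ [] ∧ r = r1 ++ s ∧ ∃ t ∈ T, s <+: t
  | [], r, q, hr, e => by simp_all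
  | t :: T, r, q, hr, e => by
    rw [List.flatten_cons] at e
    rcases List.append_eq_append_iff.1 e with ⟨c, hc, hc'⟩ | ⟨c, hc, hc'⟩
    · by_cases h0 : c = []
      · subst h0
        exact ⟨[], r, hr, rfl, t, by simp, by simp [hc]⟩
      · obtain ⟨r1, s, hs, e1, t', ht', hp⟩ := lyn_suffix T c q h0 hc'
        exact ⟨t ++ r1, s, hs, by simp [hc, e1], t', by simp [ht'], hp⟩
    · exact ⟨[], r, hr, rfl, t, by simp, ⟨c, hc.symm⟩⟩

theorem lyn_head {α : Type*} [LinearOrder α] {u v r q : List α} {T : List (List α)}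
    (hu : u ≠ []) (hv : IsLyndon v) (hc : List.IsChain (· ≥ ·) (u :: T))
    (e : v = u ++ r) (eT : T.flatten = r ++ q) : r = [] := by
  by_contra hr
  obtain ⟨r1, s, hs, e1, t, ht, hp⟩ := lyn_suffix T r q hr eT
  have h1 : t ≤ u := List.rel_of_pairwise_cons hc.pairwise ht
  have h2 : s ≤ t := not_lt.1 (List.IsPrefix.le hp)
  have h3 : v < s := hv.2 (u ++ r1) s (by simp [hu]) hs (by simp [e, e1])
  have h4 : u ≤ v := not_lt.1 (List.IsPrefix.le ⟨r, e.symm⟩)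
  exact absurd (lt_of_lt_of_le h3 (h2.trans (h1.trans h4))) (lt_irrefl _)

theorem lyn_unique {α : Type*} [LinearOrder α] : ∀ (L M : List (List α)),
    (∀ t ∈ L, IsLyndon t) → (∀ t ∈ M, IsLyndon t) → List.IsChain (· ≥ ·) L →
    List.IsChain (· ≥ ·) M → L.flatten = M.flatten → L = M
  | [], [], _, _, _, _, _ => rfl
  | [], v :: M, _, hM, _, _, e => by
    have := (hM v (by simp)).1
    simp_all
  | u :: L, [], hL, _, _, _, e => by
    have := (hL u (by simp)).1
    simp_all
  | u :: L, v :: M, hL, hM, cL, cM, e => by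
    have hu := hL u (by simp)
    have hv := hM v (by simp)
    have huv : u = v := by
      rw [List.flatten_cons, List.flatten_cons] at e
      rcases List.append_eq_append_iff.1 e with ⟨c, hc, hc'⟩ | ⟨c, hc, hc'⟩
      · have := lyn_head hu.1 hv cL hc hc'
        simp [hc, this]
      · have := lyn_head hv.1 hu cM hc hc'
        simp [hc, this]
    subst huv
    have := lyn_unique L M (fun t ht => hL t (by simp [ht])) (fun t ht => hM t (by simp [ht]))
      cL.tail cM.tail (by simpa using e)
    rw [this]

/-- Chen–Fox–Lyndon: every word over a totally ordered alphabet has a unique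
factorization `w = u₁ u₂ ⋯ u_m` into Lyndon words with
`u₁ ≥ u₂ ≥ ⋯ ≥ u_m` lexicographically. -/
theorem chen_fox_lyndon {α : Type*} [LinearOrder α] (w : List α) :
    ∃! L : List (List α),
      (∀ u ∈ L, IsLyndon u) ∧ List.Chain' (· ≥ ·) L ∧ L.flatten = w := by
  obtain ⟨L, h1, h2, h3⟩ := lyn_exists w
  refine ⟨L, ⟨h1, h2, h3⟩, ?_⟩
  rintro M ⟨m1, m2, m3⟩
  exact lyn_unique M L m1 h1 m2 h2 (m3.trans h3.symm)
end

section
/- Let \(\mu = (n, 1^k)\) with n ≥ 2, k ≥ 1, and let \(\alpha\) be a composition of n + k. The number of bi-brick permutations \(\Pi\) with inner-brick partition \(\mu(\Pi) = \mu\) and outer-brick composition \(\alpha(\Pi) = \alpha\), counted via the Kulikauskas–Remmel signed h-expansion, satisfies: the total (unsigned) coefficient of \(h_\lambda\) in \((-1)^{n+k-\ell(\mu)} m_{(n,1^k)}\), summed over compositions \(\alpha\) rearranging to \(\lambda\), is a nonnegative integer. Concretely: \((-1)^{n-1} m_{(n,1^k)} = \sum_{\lambda \vdash n+k} (-1)^{n+k-\ell(\lambda)}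 c_\lambda h_\lambda\) with all \(c_\lambda \ge 0\) integers. -/
open MvPolynomial

/-- The hook partition `(n, 1^k)` of `n + k` (for `n > 0`). -/
def hookPartition (n k : ℕ) (hn : 0 < n) : Nat.Partition (n + k) where
  parts := n ::ₘ Multiset.replicate k 1
  parts_pos := fun h => by
    rcases Multiset.mem_cons.mp h with rfl | h
    · exact hn
    · rw [Multiset.eq_of_mem_replicate h]; exact one_pos
  parts_sum := by simp [Multiset.sum_replicate]


namespace HookAux

open Finset

variable {σ : Type*} [Fintype σ] [DecidableEq σ]

/-- negated complete homogeneous polynomial -/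
noncomputable def g (σ : Type*) [Fintype σ] [DecidableEq σ] (i : ℕ) : MvPolynomial σ ℚ :=
  - hsymm σ ℚ i

/-- the cone of nonnegative integer combinations of products of `g` in degree `d` -/
noncomputable def Cone (σ : Type*) [Fintype σ] [DecidableEq σ] (d : ℕ) :
    AddSubmonoid (MvPolynomial σ ℚ) :=
  AddSubmonoid.closure (Set.range fun l : Nat.Partition d => (l.parts.map (g σ)).prod)

lemma cone_mul {a b : ℕ} {x y : MvPolynomial σ ℚ} (hx : x ∈ Cone σ a) (hy : y ∈ Cone σ b) :
    x * y ∈ Cone σ (a + b) := by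
  unfold Cone at hx hy
  induction hx using AddSubmonoid.closure_induction with
  | zero => simp
  | add x x' _ _ h h' => rw [add_mul]; exact add_mem h h'
  | mem x hx =>
    obtain ⟨l, rfl⟩ := hx
    induction hy using AddSubmonoid.closure_induction with
    | zero => simp
    | add x x' _ _ h h' => rw [mul_add]; exact add_mem h h'
    | mem y hy =>
      obtain ⟨l', rfl⟩ := hy
      refine AddSubmonoid.subset_closure ⟨⟨l.parts + l'.parts, ?_, ?_⟩, ?_⟩
      · intro i hi
        rcases Multiset.mem_add.1 hi with h | h
        · exact l.parts_pos h
        · exact l'.parts_pos h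
      · simp [l.parts_sum, l'.parts_sum]
      · simp

lemma cone_one : (1 : MvPolynomial σ ℚ) ∈ Cone σ 0 :=
  AddSubmonoid.subset_closure ⟨Nat.Partition.indiscrete 0, by simp⟩

lemma cone_g {d : ℕ} (hd : d ≠ 0) : g σ d ∈ Cone σ d :=
  AddSubmonoid.subset_closure ⟨Nat.Partition.indiscrete d, by simp [hd]⟩

lemma cone_exists {d : ℕ} {x : MvPolynomial σ ℚ} (hx : x ∈ Cone σ d) :
    ∃ c : Nat.Partition d → ℕ, x = ∑ l, (c l : MvPolynomial σ ℚ) * (l.parts.map (g σ)).prod := by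
  unfold Cone at hx
  induction hx using AddSubmonoid.closure_induction with
  | zero => exact ⟨0, by simp⟩
  | add x x' _ _ h h' =>
    obtain ⟨c, rfl⟩ := h
    obtain ⟨c', rfl⟩ := h'
    exact ⟨c + c', by simp [add_mul, Finset.sum_add_distrib]⟩
  | mem x hx =>
    obtain ⟨l, rfl⟩ := hx
    refine ⟨Pi.single l 1, ?_⟩
    rw [Finset.sum_eq_single l]
    · simp
    · intro b _ hb; simp [hb]
    · simp

/-- signed elementary polynomial -/
noncomputable def A (σ : Type*) [Fintype σ] [DecidableEq σ] (i : ℕ) : MvPolynomial σ ℚ :=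
  (-1) ^ i * esymm σ ℚ i

/-- negated power sums, with zero constant term -/
noncomputable def q (σ : Type*) [Fintype σ] [DecidableEq σ] (i : ℕ) : MvPolynomial σ ℚ :=
  if i = 0 then 0 else - psum σ ℚ i

lemma hsymm_eq (n : ℕ) : PowerSeries.coeff n
    (∏ i : σ, PowerSeries.mk (fun m => (X i : MvPolynomial σ ℚ) ^ m)) = hsymm σ ℚ n := by
  rw [PowerSeries.coeff_prod, hsymm]
  simp only [PowerSeries.coeff_mk]
  symm
  refine Finset.sum_bij' (fun s _ => Multiset.toFinsupp s.1)
    (fun l hl => ⟨Finsupp.toMultiset l, ?_⟩) ?_ ?_ ?_ ?_ ?_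
  · rw [Finset.mem_finsuppAntidiag] at hl
    rw [Finsupp.card_toMultiset, Finsupp.sum_fintype _ _ (by simp)]
    exact hl.1
  · intro s _
    rw [Finset.mem_finsuppAntidiag]
    refine ⟨?_, Finset.subset_univ _⟩
    change ∑ a : σ, Multiset.count a s.1 = n
    rw [Multiset.sum_count_eq_card (by simp)]
    exact s.2
  · intro l _; exact Finset.mem_univ _
  · intro s _
    apply Subtype.ext
    simp
  · intro l _
    simp
  · intro s _
    rw [Finset.prod_multiset_map_count]
    simp only [Multiset.toFinsupp_apply]
    apply Finset.prod_subset (Finset.subset_univ _)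
    intro x _ hx
    rw [Multiset.count_eq_zero_of_notMem (by simpa using hx), pow_zero]

lemma esymm_eq (n : ℕ) : PowerSeries.coeff n
    (∏ i : σ, (1 - PowerSeries.X * PowerSeries.C (X i : MvPolynomial σ ℚ))) = A σ n := by
  have : ∀ i : σ, (1 - PowerSeries.X * PowerSeries.C (X i : MvPolynomial σ ℚ))
     = 1 + PowerSeries.X * PowerSeries.C (-X i : MvPolynomial σ ℚ) := by
    intro i; simp [sub_eq_add_neg]
  simp only [this]
  rw [Finset.prod_one_add, map_sum, A, esymm, Finset.mul_sum,
    Finset.powersetCard_eq_filter, Finset.sum_filter]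
  refine Finset.sum_congr rfl fun T _ => ?_
  rw [Finset.prod_mul_distrib, Finset.prod_const, ← map_prod, PowerSeries.coeff_mul_C,
    PowerSeries.coeff_X_pow]
  split_ifs with h1 h2 h2
  · rw [Finset.prod_neg, h2, one_mul]
  · exact absurd h1.symm h2
  · exact absurd h2.symm h1
  · simp

lemma A_mul_H : PowerSeries.mk (A σ) * PowerSeries.mk (hsymm σ ℚ) = 1 := by
  have h1 : PowerSeries.mk (A σ) =
      ∏ i : σ, (1 - PowerSeries.X * PowerSeries.C (X i : MvPolynomial σ ℚ)) := by
    ext1 n; rw [esymm_eq, PowerSeries.coeff_mk]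
  have h2 : PowerSeries.mk (hsymm σ ℚ) =
      ∏ i : σ, PowerSeries.mk (fun m => (X i : MvPolynomial σ ℚ) ^ m) := by
    ext1 n; rw [hsymm_eq, PowerSeries.coeff_mk]
  rw [h1, h2, ← Finset.prod_mul_distrib]
  apply Finset.prod_eq_one
  intro i _
  ext1 n
  rw [sub_mul, one_mul, map_sub, mul_assoc]
  cases n with
  | zero => simp
  | succ n =>
    rw [PowerSeries.coeff_succ_X_mul, PowerSeries.coeff_C_mul]
    simp [PowerSeries.coeff_one, pow_succ']

lemma A_zero : A σ 0 = 1 := by simp [A]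

lemma A_rec {n : ℕ} (hn : n ≠ 0) :
    A σ n = ∑ p ∈ (HasAntidiagonal.antidiagonal n).filter (fun p => p.1 < n), A σ p.1 * g σ p.2 := by
  have h := congrArg (PowerSeries.coeff n) (A_mul_H (σ := σ))
  rw [PowerSeries.coeff_mul, PowerSeries.coeff_one, if_neg hn] at h
  simp only [PowerSeries.coeff_mk] at h
  rw [← Finset.sum_filter_add_sum_filter_not _ (fun p : ℕ × ℕ => p.1 < n)] at h
  have h3 : (HasAntidiagonal.antidiagonal n).filter (fun p => ¬ p.1 < n) = {(n, 0)} := by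
    ext ⟨a, b⟩
    simp only [mem_filter, HasAntidiagonal.mem_antidiagonal, mem_singleton, Prod.mk.injEq]
    omega
  rw [h3, Finset.sum_singleton, hsymm_zero, mul_one] at h
  simp only [g, mul_neg, Finset.sum_neg_distrib]
  linear_combination h

lemma A_mem (n : ℕ) : A σ n ∈ Cone σ n := by
  induction n using Nat.strong_induction_on with
  | _ n ih =>
    by_cases hn : n = 0
    · subst hn; rw [A_zero]; exact cone_one
    · rw [A_rec hn]
      refine sum_mem fun p hp => ?_
      simp only [mem_filter, HasAntidiagonal.mem_antidiagonal] at hp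
      obtain ⟨h1, h2⟩ := hp
      have := cone_mul (ih p.1 h2) (cone_g (σ := σ) (d := p.2) (by omega))
      rwa [h1] at this

lemma newton : PowerSeries.mk (A σ) * PowerSeries.mk (q σ) =
    PowerSeries.X * PowerSeries.derivative (MvPolynomial σ ℚ) (PowerSeries.mk (A σ)) := by
  ext1 n
  rw [PowerSeries.coeff_mul]
  simp only [PowerSeries.coeff_mk]
  have hR : PowerSeries.coeff n (PowerSeries.X *
      PowerSeries.derivative (MvPolynomial σ ℚ) (PowerSeries.mk (A σ))) = n * A σ n := by
    cases n with
    | zero => simp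
    | succ n =>
      rw [PowerSeries.coeff_succ_X_mul, PowerSeries.coeff_derivative, PowerSeries.coeff_mk]
      push_cast; ring
  rw [hR, A, mul_left_comm, mul_esymm_eq_sum, Finset.sum_filter, Finset.mul_sum, Finset.mul_sum]
  refine Finset.sum_congr rfl fun p hp => ?_
  rw [HasAntidiagonal.mem_antidiagonal] at hp
  have h1 : ((-1) ^ n * (-1) ^ (n + 1) : MvPolynomial σ ℚ) = -1 := by
    rw [← pow_add, Odd.neg_one_pow]; exact ⟨n, by ring⟩
  rw [← mul_assoc, h1]
  unfold A q
  by_cases h : p.2 = 0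
  · rw [if_pos h, if_neg (by omega)]; simp
  · rw [if_neg h, if_pos (by omega)]; ring

lemma q_series : PowerSeries.mk (q σ) = PowerSeries.mk (A σ) * (PowerSeries.X *
    PowerSeries.derivative (MvPolynomial σ ℚ) (-PowerSeries.mk (hsymm σ ℚ))) := by
  have h1 := A_mul_H (σ := σ)
  have h2 := newton (σ := σ)
  have h3 := congrArg (PowerSeries.derivative (MvPolynomial σ ℚ)) h1
  rw [Derivation.leibniz, Derivation.map_one_eq_zero] at h3
  simp only [smul_eq_mul] at h3
  rw [map_neg]
  linear_combination (-PowerSeries.mk (q σ)) * h1 + PowerSeries.mk (hsymm σ ℚ) * h2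
    + PowerSeries.X * h3

lemma q_mem (n : ℕ) : q σ n ∈ Cone σ n := by
  have h := congrArg (PowerSeries.coeff n) (q_series (σ := σ))
  rw [PowerSeries.coeff_mul] at h
  simp only [PowerSeries.coeff_mk] at h
  rw [h]
  refine sum_mem fun p hp => ?_
  rw [HasAntidiagonal.mem_antidiagonal] at hp
  rw [← hp]
  refine cone_mul (A_mem _) ?_
  rcases p with ⟨a, b⟩
  cases b with
  | zero => simp
  | succ b =>
    have : PowerSeries.coeff (b + 1) (PowerSeries.X *
        PowerSeries.derivative (MvPolynomial σ ℚ) (-PowerSeries.mk (hsymm σ ℚ))) =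
        (b + 1) • g σ (b + 1) := by
      rw [PowerSeries.coeff_succ_X_mul, PowerSeries.coeff_derivative, map_neg,
        PowerSeries.coeff_mk, g, nsmul_eq_mul]
      push_cast; ring
    simp only
    rw [this]
    exact nsmul_mem (cone_g (by omega)) _

/-- index set of the monomials of the hook monomial symmetric polynomial -/
def prs (σ : Type*) [Fintype σ] [DecidableEq σ] (k : ℕ) : Finset (σ × Finset σ) :=
  (univ ×ˢ powersetCard k univ).filter fun p => p.1 ∉ p.2

/-- the hook monomial symmetric polynomial -/
noncomputable def M (σ : Type*) [Fintype σ] [DecidableEq σ] (n k : ℕ) : MvPolynomial σ ℚ :=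
  ∑ p ∈ prs σ k, X p.1 ^ n * ∏ j ∈ p.2, X j

lemma M_zero (n : ℕ) : M σ n 0 = psum σ ℚ n := by
  simp only [M, prs, psum, powersetCard_zero]
  rw [Finset.sum_filter, Finset.sum_product]
  simp

lemma M_rec (n k : ℕ) : M σ n (k + 1) + M σ (n + 1) k = psum σ ℚ n * esymm σ ℚ (k + 1) := by
  rw [psum, esymm, Finset.sum_mul_sum, ← Finset.sum_product',
    ← Finset.sum_filter_add_sum_filter_not _ (fun p : σ × Finset σ => p.1 ∉ p.2)]
  unfold M
  congr 1
  refine Finset.sum_bij' (fun p _ => (p.1, insert p.1 p.2)) (fun p _ => (p.1, p.2.erase p.1))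
    ?_ ?_ ?_ ?_ ?_
  · rintro ⟨i, T⟩ h
    simp only [prs, mem_filter, mem_product, mem_univ, true_and, mem_powersetCard_univ] at h ⊢
    simp [Finset.card_insert_of_notMem h.2, h.1]
  · rintro ⟨i, T⟩ h
    simp only [prs, mem_filter, mem_product, mem_univ, true_and, mem_powersetCard_univ,
      not_not] at h ⊢
    simp [Finset.card_erase_of_mem h.2, h.1]
  · rintro ⟨i, T⟩ h
    simp only [prs, mem_filter, mem_product, mem_univ, true_and, mem_powersetCard_univ] at h ⊢
    simp [Finset.erase_insert h.2]
  · rintro ⟨i, T⟩ h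
    simp only [mem_filter, mem_product, mem_univ, true_and, mem_powersetCard_univ,
      not_not] at h ⊢
    simp [Finset.insert_erase h.2]
  · rintro ⟨i, T⟩ h
    simp only [prs, mem_filter, mem_product, mem_univ, true_and, mem_powersetCard_univ] at h ⊢
    rw [Finset.prod_insert h.2]; ring

lemma M_mem (k : ℕ) : ∀ n, 0 < n → (-1) ^ (k + 1) * M σ n k ∈ Cone σ (n + k) := by
  induction k with
  | zero =>
    intro n hn
    have := q_mem (σ := σ) n
    rw [q, if_neg (by omega)] at this
    rw [M_zero]; simpa using this
  | succ k ih =>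
    intro n hn
    have h1 := q_mem (σ := σ) n
    have h2 := cone_mul h1 (A_mem (σ := σ) (k + 1))
    have h3 := ih (n + 1) (by omega)
    rw [show n + 1 + k = n + (k + 1) by omega] at h3
    have h4 := add_mem h2 h3
    convert h4 using 1
    rw [q, if_neg (by omega), A]
    have := M_rec (σ := σ) n k
    linear_combination (-1) ^ (k + 2) * this

lemma count_pair (n : ℕ) (i : σ) (T : Finset σ) (x : σ) (hi : i ∉ T) :
    (Multiset.replicate n i + T.val).count x = if x = i then n else if x ∈ T then 1 else 0 := by
  rw [Multiset.count_add, Multiset.count_replicate]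
  by_cases h : x = i
  · subst h; simp [hi]
  · have h' : ¬ i = x := fun e => h e.symm
    rw [if_neg h', if_neg h, Multiset.count_eq_of_nodup T.nodup]; simp

lemma dedup_pair (n : ℕ) (hn : 0 < n) (i : σ) (T : Finset σ) (hi : i ∉ T) :
    (Multiset.replicate n i + T.val).dedup = i ::ₘ T.val := by
  have hnd : (i ::ₘ T.val).Nodup := Multiset.nodup_cons.2 ⟨hi, T.nodup⟩
  rw [(Multiset.nodup_dedup _).ext hnd]
  intro a
  simp [Multiset.mem_replicate, hn.ne']

lemma msymm_hook (n k : ℕ) (hn : 2 ≤ n) (h0 : 0 < n) :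
    msymm σ ℚ (hookPartition n k h0) = M σ n k := by
  symm
  unfold M msymm
  have key : ∀ p ∈ prs σ k, p.1 ∉ p.2 ∧ p.2.card = k := by
    intro p hp
    simp only [prs, mem_filter, mem_product, mem_univ, true_and, mem_powersetCard_univ] at hp
    exact ⟨hp.2, hp.1⟩
  refine Finset.sum_bij (fun p hp => ⟨⟨Multiset.replicate n p.1 + p.2.val, ?_⟩, ?_⟩) ?_ ?_ ?_ ?_
  · simp [(key p hp).2]
  · obtain ⟨h1, h2⟩ := key p hp
    apply Nat.Partition.ext
    simp only [Nat.Partition.ofSym, hookPartition]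
    rw [dedup_pair n h0 _ _ h1, Multiset.map_cons, count_pair n _ _ _ h1, if_pos rfl]
    congr 1
    rw [Multiset.eq_replicate]
    refine ⟨by simp [h2], ?_⟩
    intro b hb
    obtain ⟨a, ha, rfl⟩ := Multiset.mem_map.1 hb
    rw [count_pair n _ _ _ h1, if_neg, if_pos]
    · exact ha
    · rintro rfl; exact h1 ha
  · simp
  · rintro ⟨i, T⟩ hp ⟨i', T'⟩ hp' h
    have h1 := (key _ hp).1
    have h1' := (key _ hp').1
    have h : Multiset.replicate n i + T.val = Multiset.replicate n i' + T'.val :=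
      congrArg (fun z => z.1.1) h
    have hc : ∀ x, (if x = i then n else if x ∈ T then 1 else 0) =
        (if x = i' then n else if x ∈ T' then 1 else 0) := by
      intro x
      rw [← count_pair n _ _ _ h1, ← count_pair n _ _ _ h1']
      exact congrArg _ h
    have hi : i = i' := by
      have := hc i
      rw [if_pos rfl] at this
      by_contra hne
      rw [if_neg hne] at this
      split_ifs at this <;> omega
    subst hi
    refine Prod.ext rfl ?_
    ext x
    have := hc x
    by_cases hx : x = i
    · subst hx; exact ⟨fun h => absurd h h1, fun h => absurd h h1'⟩
    · rw [if_neg hx, if_neg hx] at this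
      simp only
      split_ifs at this <;> simp_all
  · rintro ⟨⟨s, hs⟩, hμ⟩ _
    have hp := congrArg Nat.Partition.parts hμ
    simp only [Nat.Partition.ofSym, hookPartition] at hp
    have hmem : n ∈ s.dedup.map (fun a => s.count a) := by rw [hp]; simp
    obtain ⟨i, hi, hin⟩ := Multiset.mem_map.1 hmem
    obtain ⟨r, hr⟩ := Multiset.exists_cons_of_mem hi
    rw [hr, Multiset.map_cons, hin, Multiset.cons_inj_right, Multiset.eq_replicate] at hp
    obtain ⟨hcard, hone⟩ := hp
    have hnd : (i ::ₘ r).Nodup := hr ▸ Multiset.nodup_dedup s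
    rw [Multiset.nodup_cons] at hnd
    refine ⟨(i, ⟨r, hnd.2⟩), ?_, ?_⟩
    · simp only [prs, mem_filter, mem_product, mem_univ, true_and, mem_powersetCard_univ]
      exact ⟨by simpa using hcard, hnd.1⟩
    · apply Subtype.ext
      apply Subtype.ext
      simp only
      ext x
      have := count_pair n i ⟨r, hnd.2⟩ x hnd.1
      simp only at this
      rw [this]
      split_ifs with h1 h2
      · rw [h1, hin]
      · exact (hone _ (Multiset.mem_map_of_mem _ h2)).symm
      · symm
        apply Multiset.count_eq_zero_of_notMem
        intro hx
        have : x ∈ i ::ₘ r := hr ▸ Multiset.mem_dedup.2 hx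
        rcases Multiset.mem_cons.1 this with h | h
        · exact h1 h
        · exact h2 h
  · rintro ⟨i, T⟩ hp
    simp

end HookAux

/-- For the hook `μ = (n,1^k)` with `n ≥ 2`, `k ≥ 1`, in the expansion of
`m_μ` into the `h`-basis every coefficient of `h_λ` has sign
`(-1)^(|λ|-ℓ(λ)) (-1)^(n-1)` (or vanishes): there exist nonnegative integers
`c_λ` with `(-1)^(n-1) m_{(n,1^k)} = ∑_{λ ⊢ n+k} (-1)^(n+k-ℓ(λ)) c_λ h_λ`. -/
theorem hook_msymm_h_expansion (σ : Type*) [Fintype σ] [DecidableEq σ]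
    (n k : ℕ) (hn : 2 ≤ n) (hk : 1 ≤ k) :
    ∃ c : Nat.Partition (n + k) → ℕ,
      (-1 : MvPolynomial σ ℚ) ^ (n - 1) *
          msymm σ ℚ (hookPartition n k (by omega)) =
        ∑ lam : Nat.Partition (n + k),
          (-1 : MvPolynomial σ ℚ) ^ (n + k - Multiset.card lam.parts) * (c lam : MvPolynomial σ ℚ) *
            hsymmPart σ ℚ lam := by
  obtain ⟨c, hc⟩ := HookAux.cone_exists (HookAux.M_mem (σ := σ) k n (by omega))
  refine ⟨c, ?_⟩
  rw [HookAux.msymm_hook n k hn]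
  have h1 : (-1 : MvPolynomial σ ℚ) ^ (n - 1) =
      (-1) ^ (n + k) * (-1) ^ (k + 1) := by
    rw [← pow_add, show n + k + (k + 1) = (n - 1) + 2 * (k + 1) by omega, pow_add,
      Even.neg_one_pow (n := 2 * (k + 1)) (by simp), mul_one]
  rw [h1, mul_assoc, hc, Finset.mul_sum]
  refine Finset.sum_congr rfl fun l _ => ?_
  have hcard : Multiset.card l.parts ≤ n + k := by
    have h := Multiset.card_nsmul_le_sum (s := l.parts) (a := 1) fun x hx => l.parts_pos hx
    rw [l.parts_sum] at h
    simpa using h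
  have h2 : (l.parts.map (HookAux.g σ)).prod =
      (-1) ^ (Multiset.card l.parts) * hsymmPart σ ℚ l := by
    have : HookAux.g σ = fun i => (-1) * hsymm σ ℚ i := by
      funext i; simp [HookAux.g]
    rw [this, Multiset.prod_map_mul, Multiset.map_const', Multiset.prod_replicate, hsymmPart]
  have h3 : (-1 : MvPolynomial σ ℚ) ^ (n + k) * (-1) ^ (Multiset.card l.parts) =
      (-1) ^ (n + k - Multiset.card l.parts) := by
    rw [← pow_add, show n + k + Multiset.card l.parts =
      (n + k - Multiset.card l.parts) + 2 * Multiset.card l.parts by omega, pow_add,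
      Even.neg_one_pow (n := 2 * Multiset.card l.parts) (by simp), mul_one]
  rw [h2, ← h3]
  ring
end

section
/- Setting q = 1 in Theorem 3.2's identity: for n ≥ 2 and k ≥ 1, \((-1)^{n-1} m_{(n,1^k)} = \sum_{a=1}^{n} (k + a) \sum_{\tau \models n-a} \sum_{b=0}^{k} \sum_{\rho \models k-b} (-1)^{n+k - (\ell(\tau)+1+\ell(\rho))}\, h_\tau \, h_{a+b} \, h_\rho\), where the sums over \(\tau\) and \(\rho\) run over all compositions of n−a and k−b respectively (including the empty composition), and \(h_\gamma = \prod_i h_{\gamma_i}\). -/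
open MvPolynomial

/-- For a composition `α = (α₁,…,α_ℓ)`, the product `h_α = h_{α₁} ⋯ h_{α_ℓ}`. -/
noncomputable def hComp (σ : Type*) [Fintype σ] [DecidableEq σ]
    {n : ℕ} (α : Composition n) : MvPolynomial σ ℚ :=
  (α.blocks.map (hsymm σ ℚ)).prod

section HookAux
variable (σ : Type*) [Fintype σ] [DecidableEq σ]

set_option linter.unusedSectionVars false

lemma hook_geom {R : Type*} [CommRing R] (a : R) :
    (1 - PowerSeries.C a * PowerSeries.X) * PowerSeries.mk (fun n => a ^ n) = 1 := by
  ext n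
  rw [sub_mul, one_mul, mul_assoc, map_sub, PowerSeries.coeff_C_mul]
  cases n with
  | zero => simp
  | succ n => simp [PowerSeries.coeff_succ_X_mul, pow_succ', PowerSeries.coeff_one]

lemma hook_A : (∏ i : σ, (1 - PowerSeries.C (X i : MvPolynomial σ ℚ) * PowerSeries.X)) =
    PowerSeries.mk (fun k => (-1) ^ k * esymm σ ℚ k) := by
  simp_rw [sub_eq_add_neg]
  rw [Finset.prod_one_add]
  ext1 k
  have h : ∀ t : Finset σ, ∏ i ∈ t, -(PowerSeries.C (X i : MvPolynomial σ ℚ) * PowerSeries.X)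
      = PowerSeries.C ((-1) ^ t.card * ∏ i ∈ t, X i) * PowerSeries.X ^ t.card := by
    intro t
    rw [Finset.prod_neg, Finset.prod_mul_distrib, Finset.prod_const]
    simp [mul_assoc]
  simp_rw [h]
  simp only [map_sum, PowerSeries.coeff_C_mul, PowerSeries.coeff_X_pow, PowerSeries.coeff_mk]
  rw [esymm, Finset.mul_sum, Finset.powersetCard_eq_filter, Finset.sum_filter]
  refine Finset.sum_congr rfl fun t _ => ?_
  by_cases hk : t.card = k
  · simp [hk]
  · simp [hk, Ne.symm hk]

lemma hook_B : (∏ i : σ, PowerSeries.mk (fun n => (X i : MvPolynomial σ ℚ) ^ n)) =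
    PowerSeries.mk (hsymm σ ℚ) := by
  ext1 n
  rw [PowerSeries.coeff_prod, PowerSeries.coeff_mk, hsymm]
  simp only [PowerSeries.coeff_mk]
  symm
  refine Finset.sum_bij (fun s _ => Multiset.toFinsupp s.1) ?_ ?_ ?_ ?_
  · intro s _
    simp only [Finset.mem_finsuppAntidiag, Finset.subset_univ, and_true]
    have := Multiset.toFinsupp_sum_eq s.1
    rw [s.2, Finsupp.sum_fintype _ _ (by simp)] at this
    exact this
  · intro s _ t _ h
    exact Subtype.ext (Multiset.toFinsupp.injective h)
  · intro f hf
    simp only [Finset.mem_finsuppAntidiag, Finset.subset_univ, and_true] at hf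
    refine ⟨⟨Finsupp.toMultiset f, ?_⟩, Finset.mem_univ _, by simp⟩
    rw [Finsupp.card_toMultiset, Finsupp.sum_fintype _ _ (by simp)]
    simpa using hf
  · intro s _
    rw [Finset.prod_multiset_map_count]
    simp only [Multiset.toFinsupp_apply]
    refine Finset.prod_subset (Finset.subset_univ _) ?_
    intro x _ hx
    rw [Multiset.mem_toFinset] at hx
    rw [Multiset.count_eq_zero_of_notMem hx, pow_zero]

lemma hook_AB : PowerSeries.mk (fun k => (-1) ^ k * esymm σ ℚ k) * PowerSeries.mk (hsymm σ ℚ) = 1 := by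
  rw [← hook_A, ← hook_B, ← Finset.prod_mul_distrib]
  exact Finset.prod_eq_one fun i _ => hook_geom _

lemma hook_eh (M : ℕ) (hM : 0 < M) :
    ∑ u ∈ Finset.range (M + 1), (-1) ^ u * esymm σ ℚ u * hsymm σ ℚ (M - u) = 0 := by
  have := congrArg (PowerSeries.coeff M) (hook_AB σ)
  rw [PowerSeries.coeff_mul, Finset.Nat.sum_antidiagonal_eq_sum_range_succ_mk] at this
  simpa [PowerSeries.coeff_one, hM.ne'] using this

lemma hook_newton : PowerSeries.mk (fun k => (-1) ^ k * esymm σ ℚ k) *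
      PowerSeries.mk (fun k => if k = 0 then 0 else psum σ ℚ k) =
    - PowerSeries.mk (fun k => (k : MvPolynomial σ ℚ) * ((-1) ^ k * esymm σ ℚ k)) := by
  ext1 k
  rw [PowerSeries.coeff_mul]
  simp only [PowerSeries.coeff_mk, map_neg]
  have h := mul_esymm_eq_sum σ ℚ k
  have h2 : (k : MvPolynomial σ ℚ) * ((-1) ^ k * esymm σ ℚ k) =
      (-1) ^ k * (k * esymm σ ℚ k) := by ring
  rw [h2, h, ← mul_assoc, ← pow_add, Finset.sum_filter]
  rw [show k + (k + 1) = 2 * k + 1 by ring, pow_succ, pow_mul]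
  simp only [neg_one_sq, one_pow, one_mul, neg_mul, neg_neg]
  refine Finset.sum_congr rfl fun a ha => ?_
  rw [Finset.HasAntidiagonal.mem_antidiagonal] at ha
  by_cases h0 : a.2 = 0
  · have : ¬ a.1 < k := by omega
    simp [h0, this]
  · have : a.1 < k := by omega
    simp [h0, this]

lemma hook_D : PowerSeries.mk (fun k => (-1) ^ k * esymm σ ℚ k) *
      PowerSeries.mk (fun k => (k : MvPolynomial σ ℚ) * hsymm σ ℚ k) +
    PowerSeries.mk (fun k => (k : MvPolynomial σ ℚ) * ((-1) ^ k * esymm σ ℚ k)) *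
      PowerSeries.mk (hsymm σ ℚ) = 0 := by
  ext1 k
  have := congrArg (PowerSeries.coeff k) (hook_AB σ)
  rw [PowerSeries.coeff_mul] at this
  rw [map_add, PowerSeries.coeff_mul, PowerSeries.coeff_mul, ← Finset.sum_add_distrib]
  simp only [PowerSeries.coeff_mk] at this ⊢
  have h2 := congrArg (fun z => (k : MvPolynomial σ ℚ) * z) this
  simp only [Finset.mul_sum] at h2
  have h3 : (k : MvPolynomial σ ℚ) * PowerSeries.coeff k 1 = 0 := by
    rw [PowerSeries.coeff_one]; split_ifs with h <;> simp [h]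
  rw [h3] at h2
  rw [map_zero, ← h2]
  refine Finset.sum_congr rfl fun a ha => ?_
  rw [Finset.HasAntidiagonal.mem_antidiagonal] at ha
  rw [← ha]; push_cast; ring

lemma hook_P : PowerSeries.mk (fun k => if k = 0 then 0 else psum σ ℚ k) =
    PowerSeries.mk (fun k => (-1) ^ k * esymm σ ℚ k) *
      PowerSeries.mk (fun k => (k : MvPolynomial σ ℚ) * hsymm σ ℚ k) := by
  linear_combination (-(PowerSeries.mk (fun k => if k = 0 then 0 else psum σ ℚ k))) * hook_AB σ
    + PowerSeries.mk (hsymm σ ℚ) * hook_newton σ - hook_D σ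

lemma hook_p (M : ℕ) (hM : 0 < M) : psum σ ℚ M =
    ∑ u ∈ Finset.range (M + 1), (-1) ^ u * esymm σ ℚ u *
      (((M - u : ℕ) : MvPolynomial σ ℚ) * hsymm σ ℚ (M - u)) := by
  have := congrArg (PowerSeries.coeff M) (hook_P σ)
  rw [PowerSeries.coeff_mul, Finset.Nat.sum_antidiagonal_eq_sum_range_succ_mk] at this
  simpa [hM.ne'] using this

end HookAux
lemma hook_final {R : Type*} [CommRing R] (e h : ℕ → R) (n k : ℕ) (hn : 0 < n)
    (H : ∀ M, 0 < M → ∑ u ∈ Finset.range (M + 1), (-1) ^ u * e u * h (M - u) = 0) :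
    ∑ v ∈ Finset.range (k + 1), ∑ u ∈ Finset.range (n + k - v + 1),
      ((n : R) + k - v - u) * ((-1) ^ (u + v) * e u * e v * h (n + k - v - u)) =
    ∑ v ∈ Finset.range (k + 1), ∑ u ∈ Finset.range n,
      ((n : R) + k - u) * ((-1) ^ (u + v) * e u * e v * h (n + k - v - u)) := by
  have key : ∑ v ∈ Finset.range (k + 1), ∑ w ∈ Finset.range (k - v + 1),
      ((k : R) - w) * ((-1) ^ (n + w + v) * e (n + w) * e v * h (n + k - v - (n + w))) = 0 := by
    rw [Finset.sum_comm' (t' := Finset.range (k + 1)) (s' := fun w => Finset.range (k - w + 1))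
      (by intro x y; simp only [Finset.mem_range]; omega)]
    refine Finset.sum_eq_zero fun w hw => ?_
    rw [Finset.mem_range] at hw
    rcases Nat.eq_or_lt_of_le (Nat.lt_succ_iff.mp hw) with rfl | hlt
    · simp
    · have := H (k - w) (by omega)
      rw [← mul_zero (((k : R) - w) * (-1) ^ (n + w) * e (n + w)), ← this, Finset.mul_sum]
      refine Finset.sum_congr rfl fun v _ => ?_
      rw [show n + k - v - (n + w) = k - w - v by omega, pow_add _ (n + w) v]
      ring
  rw [← sub_eq_zero, ← Finset.sum_sub_distrib, ← key]
  refine Finset.sum_congr rfl fun v hv => ?_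
  rw [Finset.mem_range] at hv
  have h0 := H (n + k - v) (by omega)
  have e1 : n + k - v + 1 = n + (k - v + 1) := by omega
  rw [e1, Finset.sum_range_add] at h0
  rw [e1, Finset.sum_range_add, add_sub_right_comm, ← Finset.sum_sub_distrib]
  have h1 : ∑ u ∈ Finset.range n,
      (((n : R) + k - v - u) * ((-1) ^ (u + v) * e u * e v * h (n + k - v - u)) -
        ((n : R) + k - u) * ((-1) ^ (u + v) * e u * e v * h (n + k - v - u))) =
      (-v * (-1) ^ v * e v) * ∑ u ∈ Finset.range n, (-1) ^ u * e u * h (n + k - v - u) := by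
    rw [Finset.mul_sum]
    refine Finset.sum_congr rfl fun u _ => ?_
    ring
  rw [h1, eq_neg_of_add_eq_zero_left h0, ← Finset.sum_neg_distrib, Finset.mul_sum,
    ← Finset.sum_add_distrib]
  refine Finset.sum_congr rfl fun u _ => ?_
  push_cast
  ring

section HookAux2
variable (σ : Type*) [Fintype σ] [DecidableEq σ]

set_option linter.unusedSectionVars false

lemma hook_comp_rec (M : ℕ) (hM : 0 < M) :
    ∑ τ : Composition M, (-1) ^ τ.length * hComp σ τ =
    ∑ u ∈ Finset.range M, -(hsymm σ ℚ (M - u) *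
      ∑ τ : Composition u, (-1) ^ τ.length * hComp σ τ) := by
  simp_rw [Finset.mul_sum, ← Finset.sum_neg_distrib]
  rw [Finset.sum_sigma']
  symm
  refine Finset.sum_bij (fun p hp => (⟨(M - p.1) :: p.2.blocks, ?_, ?_⟩ : Composition M))
    ?_ ?_ ?_ ?_
  · intro i hi
    simp only [Finset.mem_sigma, Finset.mem_range] at hp
    rcases List.mem_cons.mp hi with rfl | hi
    · omega
    · exact p.2.blocks_pos hi
  · simp only [Finset.mem_sigma, Finset.mem_range] at hp
    rw [List.sum_cons, p.2.blocks_sum]; omega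
  · intros; exact Finset.mem_univ _
  · intro a ha b hb hab
    simp only [Composition.mk.injEq, List.cons.injEq] at hab
    exact Composition.sigma_eq_iff_blocks_eq.mpr hab.2
  · intro c _
    obtain ⟨bl, hpos, hsum⟩ := c
    cases bl with
    | nil => simp at hsum; omega
    | cons x t =>
      have hx : 0 < x := hpos (by simp)
      rw [List.sum_cons] at hsum
      refine ⟨⟨t.sum, ⟨t, fun hi => hpos (List.mem_cons_of_mem _ hi), rfl⟩⟩, ?_, ?_⟩
      · simp only [Finset.mem_sigma, Finset.mem_range, Finset.mem_univ, and_true]; omega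
      · simp only [Composition.mk.injEq, List.cons.injEq, and_true]; omega
  · intro a ha
    simp only [hComp, Composition.length, List.map_cons, List.prod_cons, List.length_cons]
    ring

lemma hook_comp (H : ∀ M, 0 < M → ∑ u ∈ Finset.range (M + 1),
      (-1) ^ u * esymm σ ℚ u * hsymm σ ℚ (M - u) = 0) (M : ℕ) :
    ∑ τ : Composition M, (-1) ^ τ.length * hComp σ τ = (-1) ^ M * esymm σ ℚ M := by
  induction M using Nat.strong_induction_on with
  | _ M ih =>
    rcases Nat.eq_zero_or_pos M with rfl | hM
    · have : ∀ τ : Composition 0, (-1) ^ τ.length * hComp σ τ = 1 := by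
        intro τ
        have h1 : τ.blocks = [] := τ.blocks_eq_nil.mpr rfl
        simp [hComp, Composition.length, h1]
      simp [this, composition_card]
    · rw [hook_comp_rec σ M hM]
      have h := H M hM
      rw [Finset.sum_range_succ] at h
      simp only [Nat.sub_self, hsymm_zero, mul_one] at h
      rw [eq_neg_of_add_eq_zero_right h, ← Finset.sum_neg_distrib]
      refine Finset.sum_congr rfl fun u hu => ?_
      rw [ih u (Finset.mem_range.mp hu)]
      ring

lemma hook_parts (n k : ℕ) (i : σ) (S : Finset σ) (hi : i ∉ S) (hS : S.card = k) (hn : 0 < n) :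
    (Multiset.replicate n i + S.val).dedup.map (Multiset.replicate n i + S.val).count =
      n ::ₘ Multiset.replicate k 1 := by
  have hnd : (i ::ₘ S.val).Nodup := Multiset.nodup_cons.mpr ⟨hi, S.nodup⟩
  have h1 : (Multiset.replicate n i + S.val).dedup = i ::ₘ S.val := by
    rw [← hnd.dedup]
    apply Multiset.dedup_ext.mpr
    intro a
    simp [Multiset.mem_replicate, hn.ne']
  rw [h1, Multiset.map_cons]
  congr 1
  · rw [Multiset.count_add, Multiset.count_replicate_self, Multiset.count_eq_zero_of_notMem hi]
    rfl
  · rw [← hS]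
    refine Multiset.eq_replicate.mpr ⟨by simp, ?_⟩
    intro b hb
    obtain ⟨j, hj, rfl⟩ := Multiset.mem_map.mp hb
    have hne : i ≠ j := by rintro rfl; exact hi hj
    rw [Multiset.count_add, Multiset.count_replicate, if_neg hne,
      Multiset.count_eq_one_of_mem S.nodup hj]

lemma hook_msymm (n k : ℕ) (hn : 2 ≤ n) :
    msymm σ ℚ (hookPartition n k (by omega)) =
      ∑ i : σ, X i ^ n * ∑ S ∈ Finset.powersetCard k (Finset.univ.erase i), ∏ j ∈ S, X j := by
  simp_rw [Finset.mul_sum]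
  rw [Finset.sum_sigma', msymm]
  symm
  have aux : ∀ p : (Σ _ : σ, Finset σ), p ∈ (Finset.univ : Finset σ).sigma
      (fun i => Finset.powersetCard k (Finset.univ.erase i)) ↔ p.1 ∉ p.2 ∧ p.2.card = k := by
    intro p
    simp [Finset.mem_powersetCard, Finset.subset_erase]
  refine Finset.sum_bij (fun p hp => ⟨⟨Multiset.replicate n p.1 + p.2.val, ?_⟩, ?_⟩) ?_ ?_ ?_ ?_
  · rw [aux] at hp
    simp [hp.2]
  · rw [aux] at hp
    apply Nat.Partition.ext
    exact hook_parts σ n k p.1 p.2 hp.1 hp.2 (by omega)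
  · intros; exact Finset.mem_univ _
  · rintro ⟨i, S⟩ ha ⟨j, T⟩ hb hab
    rw [aux] at ha hb
    have hab : Multiset.replicate n i + S.val = Multiset.replicate n j + T.val :=
      congrArg (fun z => z.1.1) hab
    have hij : i = j := by
      by_contra hne
      have := congrArg (Multiset.count i) hab
      rw [Multiset.count_add, Multiset.count_add, Multiset.count_replicate_self,
        Multiset.count_replicate, if_neg (Ne.symm hne)] at this
      have h2 := Multiset.nodup_iff_count_le_one.mp T.nodup i
      omega
    subst hij
    have : S = T := Finset.val_injective (add_left_cancel hab)
    rw [this]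
  · rintro ⟨⟨s, hs⟩, hp⟩ _
    have hp : s.dedup.map s.count = n ::ₘ Multiset.replicate k 1 := congrArg (·.parts) hp
    have hmem : n ∈ s.dedup.map s.count := by rw [hp]; simp
    obtain ⟨i, hi, hin⟩ := Multiset.mem_map.mp hmem
    obtain ⟨T, hT⟩ := Multiset.exists_cons_of_mem hi
    have hnd : (i ::ₘ T).Nodup := hT ▸ s.nodup_dedup
    rw [hT, Multiset.map_cons, hin, Multiset.cons_inj_right] at hp
    have hnd' := Multiset.nodup_cons.mp hnd
    obtain ⟨hc, h1⟩ := Multiset.eq_replicate.mp hp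
    have hsT : s = Multiset.replicate n i + T := by
      ext j
      rw [Multiset.count_add, Multiset.count_replicate]
      split_ifs with hij
      · subst hij
        rw [hin, Multiset.count_eq_zero_of_notMem hnd'.1]; rfl
      · by_cases hj : j ∈ T
        · rw [h1 _ (Multiset.mem_map_of_mem _ hj), Multiset.count_eq_one_of_mem hnd'.2 hj]
        · have : j ∉ s := by
            rw [← Multiset.mem_dedup, hT, Multiset.mem_cons]
            rintro (h | h)
            · exact hij h.symm
            · exact hj h
          rw [Multiset.count_eq_zero_of_notMem this, Multiset.count_eq_zero_of_notMem hj]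
    refine ⟨⟨i, ⟨T, hnd'.2⟩⟩, (aux _).mpr ⟨hnd'.1, by simpa using hc⟩, ?_⟩
    exact Subtype.ext (Subtype.ext hsT.symm)
  · rintro ⟨i, S⟩ ha
    simp only [Multiset.map_add, Multiset.prod_add, Multiset.map_replicate,
      Multiset.prod_replicate]
    rfl

lemma hook_f (i : σ) (k : ℕ) :
    ∑ S ∈ Finset.powersetCard k (Finset.univ.erase i), ∏ j ∈ S, (X j : MvPolynomial σ ℚ) =
      ∑ j ∈ Finset.range (k + 1), (-X i) ^ j * esymm σ ℚ (k - j) := by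
  induction k with
  | zero => simp
  | succ k ih =>
    rw [Finset.sum_range_succ']
    have h2 : ∑ j ∈ Finset.range (k + 1), (-X i) ^ (j + 1) * esymm σ ℚ (k + 1 - (j + 1)) =
        (-X i) * ∑ j ∈ Finset.range (k + 1), (-X i) ^ j * esymm σ ℚ (k - j) := by
      rw [Finset.mul_sum]
      refine Finset.sum_congr rfl fun j _ => ?_
      rw [Nat.add_sub_add_right]; ring
    rw [h2, ← ih]
    have h3 : esymm σ ℚ (k + 1) =
        ∑ S ∈ Finset.powersetCard (k + 1) (Finset.univ.erase i), ∏ j ∈ S, X j +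
        X i * ∑ S ∈ Finset.powersetCard k (Finset.univ.erase i), ∏ j ∈ S, X j := by
      rw [esymm]
      conv_lhs => rw [← Finset.insert_erase (Finset.mem_univ i)]
      rw [Finset.powersetCard_succ_insert (Finset.notMem_erase i _), Finset.sum_union,
        Finset.sum_image, Finset.mul_sum]
      · congr 1
        refine Finset.sum_congr rfl fun S hS => ?_
        rw [Finset.mem_powersetCard, Finset.subset_erase] at hS
        rw [Finset.prod_insert hS.1.2]
      · intro S hS T hT hST
        simp only [Finset.mem_coe, Finset.mem_powersetCard, Finset.subset_erase] at hS hT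
        rw [← Finset.erase_insert hS.1.2, hST, Finset.erase_insert hT.1.2]
      · rw [Finset.disjoint_left]
        intro S hS hS'
        obtain ⟨T, hT, rfl⟩ := Finset.mem_image.mp hS'
        simp [Finset.mem_powersetCard, Finset.subset_erase] at hS
    rw [Nat.sub_zero, pow_zero, one_mul, h3]
    ring

lemma hook_m (n k : ℕ) (hn : 2 ≤ n) :
    msymm σ ℚ (hookPartition n k (by omega)) =
      ∑ v ∈ Finset.range (k + 1), (-1) ^ (k - v) * esymm σ ℚ v * psum σ ℚ (n + k - v) := by
  rw [hook_msymm σ n k hn, ← Finset.sum_range_reflect]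
  simp_rw [hook_f, psum, Finset.mul_sum]
  rw [Finset.sum_comm]
  refine Finset.sum_congr rfl fun j hj => Finset.sum_congr rfl fun i _ => ?_
  rw [Finset.mem_range] at hj
  rw [show k + 1 - 1 - j = k - j by omega, show k - (k - j) = j by omega,
    show n + k - (k - j) = n + j by omega, pow_add, neg_pow]
  ring

end HookAux2

lemma hook_sign {R : Type*} [CommRing R] (N x y : ℕ) (h : x + 1 + y ≤ N) :
    (-1 : R) ^ (N - (x + 1 + y)) = (-1) ^ (N + 1) * ((-1) ^ x * (-1) ^ y) := by
  rw [← pow_add, ← pow_add]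
  obtain ⟨d, rfl⟩ := Nat.exists_eq_add_of_le h
  rw [Nat.add_sub_cancel_left,
    show x + 1 + y + d + 1 + (x + y) = d + 2 * (x + y + 1) by ring, pow_add, pow_mul]
  simp

lemma hook_rhs (σ : Type*) [Fintype σ] [DecidableEq σ] (n k a : ℕ) (ha : 1 ≤ a) (han : a ≤ n) :
    (∑ τ : Composition (n - a), ∑ b ∈ Finset.range (k + 1), ∑ ρ : Composition (k - b),
          (-1 : MvPolynomial σ ℚ) ^ (n + k - (τ.length + 1 + ρ.length)) *
            hComp σ τ * hsymm σ ℚ (a + b) * hComp σ ρ) =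
    ∑ b ∈ Finset.range (k + 1), (-1) ^ (n + k + 1) * (((-1) ^ (n - a) * esymm σ ℚ (n - a)) *
      ((-1) ^ (k - b) * esymm σ ℚ (k - b)) * hsymm σ ℚ (a + b)) := by
  rw [Finset.sum_comm]
  refine Finset.sum_congr rfl fun b hb => ?_
  rw [Finset.mem_range] at hb
  rw [← hook_comp σ (hook_eh σ) (n - a), ← hook_comp σ (hook_eh σ) (k - b), Finset.sum_mul_sum,
    Finset.sum_mul, Finset.mul_sum]
  refine Finset.sum_congr rfl fun τ _ => ?_
  rw [Finset.sum_mul, Finset.mul_sum]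
  refine Finset.sum_congr rfl fun ρ _ => ?_
  have h1 := τ.length_le
  have h2 := ρ.length_le
  rw [hook_sign _ _ _ (by omega)]
  ring

/-- The `q = 1` specialization of the main theorem: for `n ≥ 2` and `k ≥ 1`,
`(-1)^(n-1) m_{(n,1^k)} = ∑_{a=1}^{n} (k+a) ∑_{τ ⊨ n-a} ∑_{b=0}^{k} ∑_{ρ ⊨ k-b}
(-1)^(n+k-(ℓ(τ)+1+ℓ(ρ))) h_τ h_{a+b} h_ρ`, where `τ`, `ρ` run over all
compositions of `n-a`, `k-b` respectively (including the empty composition). -/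
theorem hook_msymm_expansion_q_one (σ : Type*) [Fintype σ] [DecidableEq σ]
    (n k : ℕ) (hn : 2 ≤ n) (hk : 1 ≤ k) :
    (-1 : MvPolynomial σ ℚ) ^ (n - 1) * msymm σ ℚ (hookPartition n k (by omega)) =
      ∑ a ∈ Finset.Icc 1 n, ((k : MvPolynomial σ ℚ) + (a : MvPolynomial σ ℚ)) *
        ∑ τ : Composition (n - a), ∑ b ∈ Finset.range (k + 1), ∑ ρ : Composition (k - b),
          (-1 : MvPolynomial σ ℚ) ^ (n + k - (τ.length + 1 + ρ.length)) *
            hComp σ τ * hsymm σ ℚ (a + b) * hComp σ ρ := by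
  rw [hook_m σ n k hn]
  have hF := hook_final (esymm σ ℚ) (hsymm σ ℚ) n k (by omega) (hook_eh σ)
  have hL : (-1 : MvPolynomial σ ℚ) ^ (n - 1) *
      ∑ v ∈ Finset.range (k + 1), (-1) ^ (k - v) * esymm σ ℚ v * psum σ ℚ (n + k - v) =
      (-1) ^ (n + k + 1) * ∑ v ∈ Finset.range (k + 1), ∑ u ∈ Finset.range (n + k - v + 1),
      ((n : MvPolynomial σ ℚ) + k - v - u) *
        ((-1) ^ (u + v) * esymm σ ℚ u * esymm σ ℚ v * hsymm σ ℚ (n + k - v - u)) := by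
    rw [Finset.mul_sum, Finset.mul_sum]
    refine Finset.sum_congr rfl fun v hv => ?_
    rw [Finset.mem_range] at hv
    rw [hook_p σ (n + k - v) (by omega), Finset.mul_sum, Finset.mul_sum, Finset.mul_sum]
    refine Finset.sum_congr rfl fun u hu => ?_
    rw [Finset.mem_range] at hu
    obtain ⟨w, rfl⟩ := Nat.exists_eq_add_of_le (Nat.lt_succ_iff.mp hv)
    obtain ⟨m, rfl⟩ := Nat.exists_eq_add_of_le' hn
    have hc : ((m + 2 + (v + w) - v - u : ℕ) : MvPolynomial σ ℚ) =
        ((m + 2 : ℕ) : MvPolynomial σ ℚ) + ((v + w : ℕ) : MvPolynomial σ ℚ) - v - u := by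
      rw [Nat.cast_sub (by omega), Nat.cast_sub (by omega)]
      push_cast; ring
    rw [hc, Nat.add_sub_cancel_left, show m + 2 - 1 = m + 1 by omega]
    have hv2 : ((-1 : MvPolynomial σ ℚ) ^ v) * (-1) ^ v = 1 := by
      rw [← mul_pow]; simp
    have hs : (-1 : MvPolynomial σ ℚ) ^ (m + 2 + (v + w) + 1) * (-1) ^ (u + v) =
        (-1) ^ (m + 1) * (-1) ^ w * (-1) ^ u := by
      linear_combination ((-1 : MvPolynomial σ ℚ) ^ (m + 1) * (-1) ^ w * (-1) ^ u) * hv2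
    linear_combination (-(((m + 2 : ℕ) : MvPolynomial σ ℚ) + ((v + w : ℕ) : MvPolynomial σ ℚ)
      - v - u) * esymm σ ℚ u * esymm σ ℚ v * hsymm σ ℚ (m + 2 + (v + w) - v - u)) * hs
  rw [hL, hF, Finset.sum_comm, Finset.mul_sum]
  symm
  refine Finset.sum_bij (fun a _ => n - a) ?_ ?_ ?_ ?_
  · intro a ha
    rw [Finset.mem_Icc] at ha
    rw [Finset.mem_range]; omega
  · intro a ha b hb hab
    rw [Finset.mem_Icc] at ha hb
    omega
  · intro u hu
    rw [Finset.mem_range] at hu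
    exact ⟨n - u, by rw [Finset.mem_Icc]; omega, by omega⟩
  · intro a ha
    rw [Finset.mem_Icc] at ha
    rw [hook_rhs σ n k a ha.1 ha.2, ← Finset.sum_range_reflect, Finset.mul_sum, Finset.mul_sum]
    refine Finset.sum_congr rfl fun v hv => ?_
    rw [Finset.mem_range] at hv
    rw [show k + 1 - 1 - v = k - v by omega, show k - (k - v) = v by omega,
      show n + k - v - (n - a) = a + (k - v) by omega, Nat.cast_sub ha.2]
    ring
end
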